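/- arXiv:2403.18573 — 6 statements merged into one kernel-verified Lean document; each statement's English description precedes it below -/
import Mathlib

section
/- Define β̂_g := (conjugation by a_g) ∘ β_g and v̂(g,h) := z(g,h) · a_g · β_g(a_h) · v(g,h) · a_{gh}⁻¹. Then: (i) v̂(g,h) · β̂_{gh}(x) · v̂(g,h)⁻¹ = β̂_g(β̂_h(x)) for all x ∈ A, and (ii) β̂_g(v̂(h,k)) · v̂(g,hk) = (z(h,k) · z(g,hk) · z(g,h)⁻¹ · z(gh,k)⁻¹ · c(g,h,k)) · v̂(g,h) · v̂(gh,k) for all g,h,k ∈ G. In other words, the modified data has associated 3-cocycle ĉ = (dz) · c, so the cohomology class of c is unchanged. -/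
/-- Conjugation of the automorphism `β g` by the unit `a g`. -/
noncomputable def betaConj {A : Type*} [Ring A] [Algebra ℂ A] {G : Type*}
    (β : G → A ≃ₐ[ℂ] A) (a : G → Aˣ) (g : G) (x : A) : A :=
  (a g : A) * β g x * (((a g)⁻¹ : Aˣ) : A)

/-- The modified implementing unit
`v̂(g,h) := z(g,h) · a_g · β_g(a_h) · v(g,h) · a_{gh}⁻¹`, as a unit of `A`. -/
noncomputable def vHatU {A : Type*} [Ring A] [Algebra ℂ A] {G : Type*} [Group G]
    (β : G → A ≃ₐ[ℂ] A) (v : G → G → Aˣ) (a : G → Aˣ) (z : G → G → ℂˣ)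
    (g h : G) : Aˣ :=
  Units.map (algebraMap ℂ A).toMonoidHom (z g h) * a g *
    Units.map ((β g).toAlgHom.toRingHom.toMonoidHom) (a h) * v g h * (a (g * h))⁻¹

section

variable {A : Type*} [Ring A] [Algebra ℂ A] {G : Type*} [Group G]

theorem val_vHatU (β : G → A ≃ₐ[ℂ] A) (v : G → G → Aˣ) (a : G → Aˣ) (z : G → G → ℂˣ) (g h : G) :
    (vHatU β v a z g h : A) =
      (z g h : ℂ) • ((a g : A) * (β g (a h : A) * ((v g h : A) * (((a (g * h))⁻¹ : Aˣ) : A)))) := by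
  simp [vHatU, Algebra.smul_def, mul_assoc]

theorem val_inv_vHatU (β : G → A ≃ₐ[ℂ] A) (v : G → G → Aˣ) (a : G → Aˣ) (z : G → G → ℂˣ)
    (g h : G) :
    (((vHatU β v a z g h)⁻¹ : Aˣ) : A) =
      (((z g h)⁻¹ : ℂˣ) : ℂ) • ((a (g * h) : A) * ((((v g h)⁻¹ : Aˣ) : A) *
        (β g (((a h)⁻¹ : Aˣ) : A) * (((a g)⁻¹ : Aˣ) : A)))) := by
  rw [Units.inv_eq_of_mul_eq_one_right]
  rw [val_vHatU, smul_mul_smul_comm, Units.mul_inv, one_smul]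
  simp only [mul_assoc, Units.inv_mul_cancel_left, Units.mul_inv_cancel_left]
  rw [← mul_assoc (β g _) (β g _), ← map_mul, Units.mul_inv, map_one, one_mul, Units.mul_inv]

end

/-- Define `β̂_g := Ad(a_g) ∘ β_g` and
`v̂(g,h) := z(g,h) · a_g · β_g(a_h) · v(g,h) · a_{gh}⁻¹`.  Then (i) `v̂` implements the
composition of the `β̂`'s, and (ii) the modified data has associated 3-cocycle
`ĉ = (dz) · c`, so the cohomology class of `c` is unchanged. -/
theorem stmt_2
    {A : Type*} [Ring A] [Algebra ℂ A] [Nontrivial A]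
    {G : Type*} [Group G]
    (β : G → A ≃ₐ[ℂ] A) (v : G → G → Aˣ)
    (hv : ∀ (g h : G) (x : A),
      (v g h : A) * β (g * h) x * (((v g h)⁻¹ : Aˣ) : A) = β g (β h x))
    (c : G → G → G → ℂˣ)
    (hc : ∀ g h k : G,
      β g (v h k : A) * (v g (h * k) : A)
        = (c g h k : ℂ) • ((v g h : A) * (v (g * h) k : A)))
    (a : G → Aˣ) (z : G → G → ℂˣ) :
    (∀ (g h : G) (x : A),
      (vHatU β v a z g h : A) * betaConj β a (g * h) x * (((vHatU β v a z g h)⁻¹ : Aˣ) : A)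
        = betaConj β a g (betaConj β a h x))
    ∧ (∀ g h k : G,
      betaConj β a g (vHatU β v a z h k : A) * (vHatU β v a z g (h * k) : A)
        = ((z h k * z g (h * k) * (z g h)⁻¹ * (z (g * h) k)⁻¹ * c g h k : ℂˣ) : ℂ) •
            ((vHatU β v a z g h : A) * (vHatU β v a z (g * h) k : A))) := by
  refine ⟨fun g h x => ?_, fun g h k => ?_⟩
  · rw [val_vHatU, val_inv_vHatU, smul_mul_assoc, smul_mul_smul_comm, Units.mul_inv, one_smul]
    simp only [betaConj, map_mul, ← hv g h x, mul_assoc, Units.inv_mul_cancel_left]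
  · have hvk : β g (β h (a k : A)) * (β g (v h k : A) * (v g (h * k) : A)) =
        (c g h k : ℂ) • ((v g h : A) * (β (g * h) (a k : A) * (v (g * h) k : A))) := by
      rw [hc, ← hv, mul_smul_comm]
      simp only [mul_assoc, Units.inv_mul_cancel_left]
    have hinv (y : A) : β g (((a (h * k))⁻¹ : Aˣ) : A) * (β g (a (h * k) : A) * y) = y := by
      rw [← mul_assoc, ← map_mul, Units.inv_mul, map_one, one_mul]
    have hvk' (y : A) : β g (β h (a k : A)) * (β g (v h k : A) * ((v g (h * k) : A) * y)) =
        (c g h k : ℂ) • ((v g h : A) * (β (g * h) (a k : A) * ((v (g * h) k : A) * y))) := by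
      simpa only [mul_assoc, smul_mul_assoc] using congrArg (· * y) hvk
    simp only [betaConj, val_vHatU, map_mul, map_smul, smul_mul_assoc, mul_smul_comm, mul_assoc,
      Units.inv_mul_cancel_left, hinv, hvk', smul_smul]
    congr 1
    push_cast
    field_simp
end

section
/- The family σ satisfies the c-twisted 2-cocycle (pentagon) equation: σ_x(g,h) · σ_x(gh,k) = c(g,h,k) · σ_{x·g}(h,k) · σ_x(g,hk) for all x ∈ X and all g,h,k ∈ G. -/
/-- The family `σ` satisfies the `c`-twisted 2-cocycle (pentagon)
equation: `σ_x(g,h) · σ_x(gh,k) = c(g,h,k) · σ_{x·g}(h,k) · σ_x(g,hk)` for all `x ∈ X`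
and all `g,h,k ∈ G`. -/
theorem stmt_4
    {A : Type*} [Ring A] [Algebra ℂ A] [Nontrivial A]
    {G : Type*} [Group G]
    {X : Type*} (act : X → G → X)
    (hact1 : ∀ x, act x 1 = x)
    (hactmul : ∀ (x : X) (g h : G), act x (g * h) = act (act x g) h)
    (β : G → A ≃ₐ[ℂ] A) (v : G → G → Aˣ)
    (hv : ∀ (g h : G) (a : A),
      (v g h : A) * β (g * h) a * (((v g h)⁻¹ : Aˣ) : A) = β g (β h a))
    (c : G → G → G → ℂˣ)
    (hc : ∀ g h k : G,
      β g (v h k : A) * (v g (h * k) : A)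
        = (c g h k : ℂ) • ((v g h : A) * (v (g * h) k : A)))
    (H : X → Type*)
    [∀ x, NormedAddCommGroup (H x)] [∀ x, InnerProductSpace ℂ (H x)]
    [∀ x, CompleteSpace (H x)] [∀ x, Nontrivial (H x)]
    (π : ∀ x, A →ₐ[ℂ] (H x →L[ℂ] H x))
    (u : ∀ (x : X) (g : G), H (act x g) ≃L[ℂ] H x)
    (hu : ∀ (x : X) (g : G) (a : A) (ξ : H (act x g)),
      u x g (π (act x g) a ξ) = π x (β g a) (u x g ξ))
    (σ : X → G → G → ℂˣ)
    (hσ : ∀ (x : X) (g h : G) (ξ : H (act x (g * h))),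
      u x g (u (act x g) h (cast (congrArg H (hactmul x g h)) ξ))
        = ((σ x g h : ℂˣ) : ℂ) • (π x (v g h : A) (u x (g * h) ξ))) :
    ∀ (x : X) (g h k : G),
      σ x g h * σ x (g * h) k = c g h k * σ (act x g) h k * σ x g (h * k) := by
  intro x g h k
  have hσ' : ∀ (x : X) (g h : G) (ξ : H (act x (g * h))) (η : H (act (act x g) h)),
      HEq ξ η → u x g (u (act x g) h η)
        = ((σ x g h : ℂˣ) : ℂ) • (π x (v g h : A) (u x (g * h) ξ)) := by
    intro x g h ξ η hη
    rw [← hσ, eq_of_heq ((cast_heq _ ξ).trans hη)]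
  have u_point : ∀ (y y' : X), y = y' → ∀ (ξ : H (act y k)) (η : H (act y' k)),
      HEq ξ η → HEq (u y k ξ) (u y' k η) := by
    rintro y _ rfl ξ η hη
    rw [eq_of_heq hη]
  have u_group : ∀ (a b : G), a = b → ∀ (ξ : H (act x a)) (η : H (act x b)),
      HEq ξ η → u x a ξ = u x b η := by
    rintro a _ rfl ξ η hη
    rw [eq_of_heq hη]
  have exists_heq : ∀ (y y' : X), y = y' → ∀ ξ : H y, ∃ η : H y', HEq ξ η := by
    rintro y _ rfl ξ
    exact ⟨ξ, HEq.rfl⟩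
  obtain ⟨ξ, hξ⟩ := exists_ne (0 : H (act x (g * h * k)))
  obtain ⟨ξ₁, h₁⟩ := exists_heq _ _ (hactmul x (g * h) k) ξ
  obtain ⟨ξ₂, h₂⟩ := exists_heq _ (act (act (act x g) h) k) (by rw [hactmul x g h]) ξ₁
  obtain ⟨ξ₃, h₃⟩ := exists_heq _ (act x (g * (h * k))) (by rw [mul_assoc]) ξ
  obtain ⟨ξ₄, h₄⟩ := exists_heq _ _ (hactmul x g (h * k)) ξ₃
  have left_assoc := hσ' x g h _ _ (u_point _ _ (hactmul x g h) _ _ h₂)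
  rw [hσ' x (g * h) k ξ ξ₁ h₁, hσ' (act x g) h k ξ₄ ξ₂ (h₄.symm.trans (h₃.symm.trans (h₁.trans h₂))),
    map_smul, hu, hσ' x g (h * k) ξ₃ ξ₄ h₄,
    ← u_group _ _ (mul_assoc g h k) ξ ξ₃ h₃] at left_assoc
  simp only [map_smul, smul_smul] at left_assoc
  simp only [← mul_apply_eq_comp, ← map_mul] at left_assoc
  rw [hc, map_smul, smul_apply, smul_smul] at left_assoc
  have ne_zero : π x ((v g h : A) * (v (g * h) k : A)) (u x (g * h * k) ξ) ≠ 0 := by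
    intro h0
    have hinv := congrArg (π x ((v g h * v (g * h) k)⁻¹ : Aˣ)) h0
    rw [← Units.val_mul, ← mul_apply_eq_comp, ← map_mul, Units.inv_mul, map_one,
      one_apply_eq_self, map_zero] at hinv
    exact hξ ((u x (g * h * k)).map_eq_zero_iff.mp hinv)
  have scalars := smul_left_injective ℂ ne_zero left_assoc
  ext
  push_cast
  linear_combination -scalars
end

section
/- Define v̂(g,h) := z(g,h) · b_g · β_g(b_h) · v(g,h) · b_{gh}⁻¹, π̂_x(a) := W_x ∘ π_x(a) ∘ W_x⁻¹, and û_{x,g} := ζ_x(g) · (W_x ∘ π_x(b_g) ∘ u_{x,g} ∘ W_{x·g}⁻¹). Then û_{x,g} ∘ û_{x·g,h} = (ζ_x(g) · ζ_{x·g}(h) · ζ_x(gh)⁻¹ · z(g,h)⁻¹ · σ_x(g,h)) · (π̂_x(v̂(g,h)) ∘ û_{x,gh}) for all x ∈ X and g,h ∈ G. In other words the modified data has σ̂ = (dζ) · z⁻¹ · σ, so the invariant class [(σ, c)] is independent of the choices made. -/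
theorem ContinuousLinearEquiv.symm_cast_apply {X : Type*} {H H' : X → Type*}
    [∀ x, NormedAddCommGroup (H x)] [∀ x, InnerProductSpace ℂ (H x)]
    [∀ x, NormedAddCommGroup (H' x)] [∀ x, InnerProductSpace ℂ (H' x)]
    (W : ∀ x, H x ≃L[ℂ] H' x) {x y : X} (hxy : x = y) (ξ : H' x) :
    (W y).symm (cast (congrArg H' hxy) ξ) = cast (congrArg H hxy) ((W x).symm ξ) := by
  subst hxy
  rfl

/-- Define `v̂(g,h) := z(g,h) · b_g · β_g(b_h) · v(g,h) · b_{gh}⁻¹`,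
`π̂_x(a) := W_x ∘ π_x(a) ∘ W_x⁻¹`, and
`û_{x,g} := ζ_x(g) · (W_x ∘ π_x(b_g) ∘ u_{x,g} ∘ W_{x·g}⁻¹)`.  Then
`û_{x,g} ∘ û_{x·g,h} = (ζ_x(g)·ζ_{x·g}(h)·ζ_x(gh)⁻¹·z(g,h)⁻¹·σ_x(g,h)) ·
(π̂_x(v̂(g,h)) ∘ û_{x,gh})`, i.e. the modified data has `σ̂ = (dζ) · z⁻¹ · σ`, so the
invariant class `[(σ,c)]` is independent of the choices made. -/
theorem stmt_6
    {A : Type*} [Ring A] [Algebra ℂ A] [Nontrivial A]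
    {G : Type*} [Group G]
    {X : Type*} (act : X → G → X)
    (hact1 : ∀ x, act x 1 = x)
    (hactmul : ∀ (x : X) (g h : G), act x (g * h) = act (act x g) h)
    (β : G → A ≃ₐ[ℂ] A) (v : G → G → Aˣ)
    (hv : ∀ (g h : G) (a : A),
      (v g h : A) * β (g * h) a * (((v g h)⁻¹ : Aˣ) : A) = β g (β h a))
    (H : X → Type*)
    [∀ x, NormedAddCommGroup (H x)] [∀ x, InnerProductSpace ℂ (H x)]
    [∀ x, CompleteSpace (H x)] [∀ x, Nontrivial (H x)]
    (π : ∀ x, A →ₐ[ℂ] (H x →L[ℂ] H x))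
    (u : ∀ (x : X) (g : G), H (act x g) ≃L[ℂ] H x)
    (hu : ∀ (x : X) (g : G) (a : A) (ξ : H (act x g)),
      u x g (π (act x g) a ξ) = π x (β g a) (u x g ξ))
    (σ : X → G → G → ℂˣ)
    (hσ : ∀ (x : X) (g h : G) (ξ : H (act x (g * h))),
      u x g (u (act x g) h (cast (congrArg H (hactmul x g h)) ξ))
        = ((σ x g h : ℂˣ) : ℂ) • (π x (v g h : A) (u x (g * h) ξ)))
    -- data for the second choice
    (H' : X → Type*)
    [∀ x, NormedAddCommGroup (H' x)] [∀ x, InnerProductSpace ℂ (H' x)]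
    [∀ x, CompleteSpace (H' x)]
    (W : ∀ x, H x ≃L[ℂ] H' x)
    (b : G → Aˣ) (z : G → G → ℂˣ) (ζ : X → G → ℂˣ) :
    ∀ (x : X) (g h : G) (ξ : H' (act x (g * h))),
      -- û_{x,g} (û_{x·g,h} ξ)
      (ζ x g : ℂ) • (W x (π x (b g : A) (u x g ((W (act x g)).symm
        ((ζ (act x g) h : ℂ) • (W (act x g) (π (act x g) (b h : A) (u (act x g) h
          ((W (act (act x g) h)).symm (cast (congrArg H' (hactmul x g h)) ξ))))))))))
      = ((ζ x g * ζ (act x g) h * (ζ x (g * h))⁻¹ * (z g h)⁻¹ * σ x g h : ℂˣ) : ℂ) •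
          -- π̂_x (v̂(g,h)) (û_{x,gh} ξ)
          (W x (π x ((z g h : ℂ) •
              ((b g : A) * β g (b h : A) * (v g h : A) * (((b (g * h))⁻¹ : Aˣ) : A)))
            ((W x).symm ((ζ x (g * h) : ℂ) • (W x (π x (b (g * h) : A)
              (u x (g * h) ((W (act x (g * h))).symm ξ)))))))) := by
  intro x g h ξ
  rw [ContinuousLinearEquiv.symm_cast_apply W (hactmul x g h) ξ]
  generalize (W (act x (g * h))).symm ξ = η
  have hb : π x (((b (g * h))⁻¹ : Aˣ) : A) (π x (b (g * h) : A) (u x (g * h) η)) =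
      u x (g * h) η := by
    rw [← mul_apply_eq_comp, ← map_mul, Units.inv_mul, map_one,
      one_apply_eq_self]
  simp only [map_smul, map_mul, ContinuousLinearEquiv.symm_apply_apply, hu, hσ,
    smul_apply, mul_apply_eq_comp, hb, smul_smul]
  congr 1
  have hz := (z g h).ne_zero
  have hζ := (ζ x (g * h)).ne_zero
  push_cast
  field_simp
end

section
/- Let a be an MPS tensor with physical dimension d and bond dimension D such that the blocking map at n sites, X ↦ Σ_{i∈(Fin d)ⁿ} Tr(X·a_i)·e_{i₁}⊗⋯⊗e_{i_n}, is injective. Let V_L and V_R be finite-dimensional complex vector spaces and let v, w : Fin D → V_L and u, z : Fin D → V_R be families of vectors, all four families nonzero, such that for every tuple i ∈ (Fin d)ⁿ one has Σ_{α,β} (a_i)_{αβ} · v_α ⊗ u_β = Σ_{α,β} (a_i)_{αβ} · w_α ⊗ z_β in V_L ⊗ V_R. Then there exists μ ∈ ℂ, μ ≠ 0, such that v_α = μ·w_α for all α and u_β = μ⁻¹·z_β for all β. -/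
open scoped TensorProduct

/-- The ordered matrix product `a_{i₁}·a_{i₂}·⋯·a_{i_n}` associated to an MPS tensor `a`
and a tuple of physical indices `i`. -/
noncomputable def matWord {d D : ℕ} (a : Fin d → Matrix (Fin D) (Fin D) ℂ)
    {n : ℕ} (i : Fin n → Fin d) : Matrix (Fin D) (Fin D) ℂ :=
  (List.ofFn fun t => a (i t)).prod

/-- If every matrix is determined by its trace pairings with the family `A`, then two boundary
decorations with the same `A`-weighted sums agree entrywise after applying linear functionals. -/
theorem dual_mul_dual_eq_of_trace_injective {K ι κ VL VR : Type*} [Field K] [Fintype ι]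
    [AddCommGroup VL] [Module K VL] [AddCommGroup VR] [Module K VR]
    (A : κ → Matrix ι ι K)
    (hinj : Function.Injective fun X : Matrix ι ι K => fun k => (X * A k).trace)
    {v w : ι → VL} {u z : ι → VR}
    (heq : ∀ k, (∑ α, ∑ β, A k α β • (v α ⊗ₜ[K] u β)) = ∑ α, ∑ β, A k α β • (w α ⊗ₜ[K] z β))
    (f : Module.Dual K VL) (g : Module.Dual K VR) (α β : ι) :
    f (v α) * g (u β) = f (w α) * g (z β) := by
  have trace_eq (v : ι → VL) (u : ι → VR) (k : κ) :
      ((Matrix.of fun β α => f (v α) * g (u β)) * A k).trace =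
        LinearMap.mul' K K (TensorProduct.map f g (∑ α, ∑ β, A k α β • (v α ⊗ₜ[K] u β))) := by
    simp only [Matrix.trace, Matrix.diag, Matrix.mul_apply, Matrix.of_apply, map_sum, map_smul,
      TensorProduct.map_tmul, LinearMap.mul'_apply, smul_eq_mul]
    rw [Finset.sum_comm]
    simp only [mul_comm]
  have key : (Matrix.of fun β α => f (v α) * g (u β)) =
      Matrix.of fun β α => f (w α) * g (z β) :=
    hinj (funext fun k => by simp only [trace_eq, heq])
  exact congrFun (congrFun key β) α

/-- Two families of vectors whose products of linear functionals agree coincide up to a scalar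
and its inverse. -/
theorem exists_smul_eq_of_dual_mul_dual_eq {K ι κ VL VR : Type*} [Field K]
    [AddCommGroup VL] [Module K VL] [AddCommGroup VR] [Module K VR]
    {v w : ι → VL} {u z : κ → VR} (hv : v ≠ 0) (hu : u ≠ 0)
    (h : ∀ (f : Module.Dual K VL) (g : Module.Dual K VR) α β,
      f (v α) * g (u β) = f (w α) * g (z β)) :
    ∃ μ : K, μ ≠ 0 ∧ (∀ α, v α = μ • w α) ∧ ∀ β, u β = μ⁻¹ • z β := by
  obtain ⟨β₀, hβ₀⟩ := Function.ne_iff.mp hu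
  obtain ⟨α₀, hα₀⟩ := Function.ne_iff.mp hv
  obtain ⟨g₀, hg₀⟩ : ∃ g : Module.Dual K VR, g (u β₀) ≠ 0 := by
    by_contra! hg
    exact hβ₀ ((Module.forall_dual_apply_eq_zero_iff K _).mp hg)
  obtain ⟨f₀, hf₀⟩ : ∃ f : Module.Dual K VL, f (v α₀) ≠ 0 := by
    by_contra! hf
    exact hα₀ ((Module.forall_dual_apply_eq_zero_iff K _).mp hf)
  have hv_eq (α : ι) : v α = ((g₀ (u β₀))⁻¹ * g₀ (z β₀)) • w α := by
    rw [← sub_eq_zero, ← Module.forall_dual_apply_eq_zero_iff K]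
    intro f
    rw [map_sub, map_smul, smul_eq_mul, sub_eq_zero]
    field_simp
    linear_combination h f g₀ α β₀
  generalize (g₀ (u β₀))⁻¹ * g₀ (z β₀) = μ at hv_eq
  have hμ : μ ≠ 0 := by
    rintro rfl
    exact hα₀ (by simp [hv_eq])
  refine ⟨μ, hμ, hv_eq, fun β => ?_⟩
  have hfw : f₀ (w α₀) ≠ 0 := fun h0 => hf₀ (by simp [hv_eq, h0])
  rw [eq_inv_smul_iff₀ hμ, ← sub_eq_zero, ← Module.forall_dual_apply_eq_zero_iff K]
  intro g
  have hfg := h f₀ g α₀ β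
  rw [hv_eq, map_smul, smul_eq_mul] at hfg
  rw [map_sub, map_smul, smul_eq_mul, sub_eq_zero]
  apply mul_left_cancel₀ hfw
  linear_combination hfg

/-- If the blocking map of `a` at `n` sites is injective and the two
boundary decorations `(v,u)` and `(w,z)` give the same boundary-decorated MPS for every
word of length `n`, then they agree up to a single nonzero scalar `μ`:
`v = μ·w` and `u = μ⁻¹·z`. -/
theorem stmt_9 {d D n : ℕ}
    (a : Fin d → Matrix (Fin D) (Fin D) ℂ)
    (hinj : Function.Injective fun X : Matrix (Fin D) (Fin D) ℂ =>
      fun i : Fin n → Fin d => (X * matWord a i).trace)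
    (VL VR : Type*) [AddCommGroup VL] [Module ℂ VL] [FiniteDimensional ℂ VL]
    [AddCommGroup VR] [Module ℂ VR] [FiniteDimensional ℂ VR]
    (v w : Fin D → VL) (u z : Fin D → VR)
    (hv : v ≠ 0) (hw : w ≠ 0) (hu : u ≠ 0) (hz : z ≠ 0)
    (heq : ∀ i : Fin n → Fin d,
      (∑ α : Fin D, ∑ β : Fin D, matWord a i α β • (v α ⊗ₜ[ℂ] u β))
        = ∑ α : Fin D, ∑ β : Fin D, matWord a i α β • (w α ⊗ₜ[ℂ] z β)) :
    ∃ μ : ℂ, μ ≠ 0 ∧ (∀ α, v α = μ • w α) ∧ (∀ β, u β = μ⁻¹ • z β) := by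
  exact exists_smul_eq_of_dual_mul_dual_eq hv hu
    (dual_mul_dual_eq_of_trace_injective (matWord a) hinj heq)
end

section
/- The linear map φ_L : (ℂ^d)^{⊗n} ⊗ M_D(ℂ) → (ℂ^d)^{⊗(n+1)} ⊗ M_D(ℂ) determined by φ_L(v ⊗ m) = Σ_{i ∈ Fin d} (e_i ⊗ v) ⊗ (A_i·m) preserves the inner products: ⟨φ_L(ξ), φ_L(η)⟩ = ⟨ξ, η⟩ for all ξ, η, i.e. φ_L is an isometry. (This is the map extending a local vector of the GNS space of an injective MPS by one site to the left; the proof uses the fixed-point equation Σ_i A_i*·ρ·A_i = ρ.) -/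
open Matrix
open scoped ComplexOrder

/-- The GNS inner product on `(ℂ^d)^{⊗n} ⊗ M_D(ℂ)`, realized on matrix-valued
functions of the physical indices: `⟨ξ, η⟩ := Σ_i Tr((ξ i)* · ρ · (η i))`.
(The identification sends `v ⊗ m` to the function `i ↦ v_i • m`, under which
`⟨v ⊗ m, w ⊗ m′⟩ = ⟨v, w⟩ · Tr(m*·ρ·m′)`.) -/
noncomputable def gnsInner {d D : ℕ} (ρ : Matrix (Fin D) (Fin D) ℂ) {n : ℕ}
    (ξ η : (Fin n → Fin d) → Matrix (Fin D) (Fin D) ℂ) : ℂ :=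
  ∑ i : Fin n → Fin d, ((ξ i)ᴴ * ρ * η i).trace

/-- The map extending a local GNS vector by one site to the left; it is determined by
`φ_L(v ⊗ m) = Σ_i (e_i ⊗ v) ⊗ (A_i·m)`. -/
noncomputable def phiL {d D : ℕ} (A : Fin d → Matrix (Fin D) (Fin D) ℂ) {n : ℕ}
    (ξ : (Fin n → Fin d) → Matrix (Fin D) (Fin D) ℂ) :
    (Fin (n + 1) → Fin d) → Matrix (Fin D) (Fin D) ℂ :=
  fun i => A (i 0) * ξ (Fin.tail i)

/-- The left-extension map `φ_L` preserves the GNS inner products,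
i.e. it is an isometry.  (The proof uses the fixed-point equation
`Σ_i A_i*·ρ·A_i = ρ`.) -/
theorem stmt_13 {d D : ℕ} (hd : 1 ≤ d) (hD : 1 ≤ D)
    (A : Fin d → Matrix (Fin D) (Fin D) ℂ)
    (hcan : ∑ i : Fin d, A i * (A i)ᴴ = 1)
    (ρ : Matrix (Fin D) (Fin D) ℂ) (hρ : ρ.PosDef)
    (hfix : ∑ i : Fin d, (A i)ᴴ * ρ * A i = ρ) :
    ∀ (n : ℕ) (ξ η : (Fin n → Fin d) → Matrix (Fin D) (Fin D) ℂ),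
      gnsInner ρ (phiL A ξ) (phiL A η) = gnsInner ρ ξ η := by
  intro n ξ η
  unfold gnsInner phiL
  rw [← (Fin.consEquiv fun _ => Fin d).sum_comp, Fintype.sum_prod_type_right]
  refine Finset.sum_congr rfl fun i _ => ?_
  have tail_cons (x : Fin d) : Fin.tail (Fin.consEquiv (fun _ => Fin d) (x, i)) = i := rfl
  conv_rhs => rw [← hfix]
  rw [Finset.mul_sum, Finset.sum_mul, Matrix.trace_sum]
  simp only [tail_cons, Fin.consEquiv_apply, Fin.cons_zero, Matrix.conjTranspose_mul,
    Matrix.mul_assoc]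
end

section
/- For all n ≥ 0, all m, k > M, and all X ∈ (M_d(ℂ))^{⊗n}, the maps β^{n,m,k} are compatible with tensoring by the identity: β^{n+1,m,k}(1_d ⊗ X) = β^{n,m+1,k}(X) = 1_{M_d} ⊗ β^{n,m,k}(X) and β^{n+1,m,k}(X ⊗ 1_d) = β^{n,m,k+1}(X) = β^{n,m,k}(X) ⊗ 1_{M_d}. (Hence the finite-size maps β^{n,m,k} consistently define a single map β on local observables.) -/
open Matrix
open scoped Kronecker

/-- The stacked two-layer MPO chain
`T^{(N)}_{i,k} := Σ_j (u_{i₁j₁}·⋯·u_{i_Nj_N}) ⊗ (ū_{j₁k₁}·⋯·ū_{j_Nk_N})`. -/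
noncomputable def chainT {d D D' : ℕ}
    (u : Fin d → Fin d → Matrix (Fin D) (Fin D) ℂ)
    (ub : Fin d → Fin d → Matrix (Fin D') (Fin D') ℂ)
    {N : ℕ} (i k : Fin N → Fin d) :
    Matrix (Fin D × Fin D') (Fin D × Fin D') ℂ :=
  ∑ j : Fin N → Fin d,
    ((List.ofFn fun t => u (i t) (j t)).prod) ⊗ₖ ((List.ofFn fun t => ub (j t) (k t)).prod)

/-- The conjugation `B^{(N)}(Y)` of an `N`-site operator `Y` by the MPU, with
boundaries closed by the fusion data `(w, φ)`:
`B(Y)_{I,K} := Σ_{J,J′} Y_{J,J′} · φ((u_{I₁J₁}⋯ ⊗ ū_{J′₁K₁}⋯)·w)`. -/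
noncomputable def Bmap {d D D' : ℕ}
    (u : Fin d → Fin d → Matrix (Fin D) (Fin D) ℂ)
    (ub : Fin d → Fin d → Matrix (Fin D') (Fin D') ℂ)
    (φ w : Fin D × Fin D' → ℂ)
    {N : ℕ} (Y : Matrix (Fin N → Fin d) (Fin N → Fin d) ℂ) :
    Matrix (Fin N → Fin d) (Fin N → Fin d) ℂ :=
  Matrix.of fun I K => ∑ J : Fin N → Fin d, ∑ J' : Fin N → Fin d,
    Y J J' * ∑ p, φ p *
      ((((List.ofFn fun t => u (I t) (J t)).prod) ⊗ₖ
        ((List.ofFn fun t => ub (J' t) (K t)).prod)).mulVec w p)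

/-- Left third of a tuple of length `m + n + k`. -/
def leftPart {d : ℕ} (m n k : ℕ) (I : Fin (m + n + k) → Fin d) : Fin m → Fin d :=
  fun t => I (Fin.castAdd k (Fin.castAdd n t))

/-- Middle third of a tuple of length `m + n + k`. -/
def midPart {d : ℕ} (m n k : ℕ) (I : Fin (m + n + k) → Fin d) : Fin n → Fin d :=
  fun t => I (Fin.castAdd k (Fin.natAdd m t))

/-- Right third of a tuple of length `m + n + k`. -/
def rightPart {d : ℕ} (m n k : ℕ) (I : Fin (m + n + k) → Fin d) : Fin k → Fin d :=
  fun t => I (Fin.natAdd (m + n) t)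

/-- `β^{n,m,k}(X) := B^{(m+n+k)}(1^{⊗m} ⊗ X ⊗ 1^{⊗k})`: the conjugation of the local
observable `X` (on `n` sites, padded by identities on `m` sites to the left and `k`
sites to the right) by the matrix product unitary. -/
noncomputable def betaMap {d D D' : ℕ}
    (u : Fin d → Fin d → Matrix (Fin D) (Fin D) ℂ)
    (ub : Fin d → Fin d → Matrix (Fin D') (Fin D') ℂ)
    (φ w : Fin D × Fin D' → ℂ)
    (n m k : ℕ) (X : Matrix (Fin n → Fin d) (Fin n → Fin d) ℂ) :
    Matrix (Fin (m + n + k) → Fin d) (Fin (m + n + k) → Fin d) ℂ :=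
  Bmap u ub φ w (Matrix.of fun I K =>
    (if leftPart m n k I = leftPart m n k K then 1 else 0) *
    (if rightPart m n k I = rightPart m n k K then 1 else 0) *
    X (midPart m n k I) (midPart m n k K))

/-- `1_{M_d} ⊗ X` as an operator on `N + 1` sites (identity on the leftmost site). -/
def idTensorLeft {d N : ℕ} (X : Matrix (Fin N → Fin d) (Fin N → Fin d) ℂ) :
    Matrix (Fin (N + 1) → Fin d) (Fin (N + 1) → Fin d) ℂ :=
  Matrix.of fun I K =>
    (if I 0 = K 0 then 1 else 0) * X (Fin.tail I) (Fin.tail K)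

/-- `X ⊗ 1_{M_d}` as an operator on `N + 1` sites (identity on the rightmost site). -/
def tensorIdRight {d N : ℕ} (X : Matrix (Fin N → Fin d) (Fin N → Fin d) ℂ) :
    Matrix (Fin (N + 1) → Fin d) (Fin (N + 1) → Fin d) ℂ :=
  Matrix.of fun I K =>
    X (Fin.init I) (Fin.init K) * (if I (Fin.last N) = K (Fin.last N) then 1 else 0)

/-- Reindexing an operator along an equality of chain lengths. -/
def recast {d N N' : ℕ} (h : N = N')
    (Y : Matrix (Fin N → Fin d) (Fin N → Fin d) ℂ) :
    Matrix (Fin N' → Fin d) (Fin N' → Fin d) ℂ :=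
  Matrix.of fun I K => Y (I ∘ Fin.cast h) (K ∘ Fin.cast h)

/-- The product of the tensors `u (I t) (J t)` along a chain of length `N`. -/
noncomputable def chainProd {d D N : ℕ} (u : Fin d → Fin d → Matrix (Fin D) (Fin D) ℂ)
    (I J : Fin N → Fin d) : Matrix (Fin D) (Fin D) ℂ :=
  (List.ofFn fun t => u (I t) (J t)).prod

theorem chainProd_append {d D m n : ℕ} (u : Fin d → Fin d → Matrix (Fin D) (Fin D) ℂ)
    (i i' : Fin m → Fin d) (j j' : Fin n → Fin d) :
    chainProd u (Fin.append i j) (Fin.append i' j') = chainProd u i i' * chainProd u j j' := by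
  rw [chainProd, chainProd, chainProd, ← List.prod_append, ← List.ofFn_fin_append]
  congr 2
  funext t
  refine Fin.addCases (fun t => ?_) (fun t => ?_) t <;> simp

theorem sum_append {A α : Type*} [AddCommMonoid A] [Fintype α] {m n : ℕ}
    (f : (Fin (m + n) → α) → A) :
    ∑ J, f J = ∑ a : Fin m → α, ∑ b : Fin n → α, f (Fin.append a b) := by
  rw [← Fintype.sum_prod_type', ← (Fin.appendEquiv m n).sum_comp]
  rfl

section Chain

variable {d D D' : ℕ} (u : Fin d → Fin d → Matrix (Fin D) (Fin D) ℂ)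
  (ub : Fin d → Fin d → Matrix (Fin D') (Fin D') ℂ)

theorem chainT_eq_sum {N : ℕ} (i k : Fin N → Fin d) :
    chainT u ub i k = ∑ j, chainProd u i j ⊗ₖ chainProd ub j k :=
  rfl

theorem chainT_append {m n : ℕ} (i i' : Fin m → Fin d) (j j' : Fin n → Fin d) :
    chainT u ub (Fin.append i j) (Fin.append i' j') = chainT u ub i i' * chainT u ub j j' := by
  simp only [chainT_eq_sum, sum_append, chainProd_append, Matrix.mul_kronecker_mul,
    Finset.sum_mul_sum]

theorem chainT_cast {N N' : ℕ} (h : N = N') (i k : Fin N' → Fin d) :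
    chainT u ub (i ∘ Fin.cast h) (k ∘ Fin.cast h) = chainT u ub i k := by
  subst h
  rfl

theorem chainT_zero (i k : Fin 0 → Fin d) : chainT u ub i k = 1 := by
  simp [chainT]

theorem chainT_succ {N : ℕ} (i k : Fin (N + 1) → Fin d) :
    chainT u ub i k =
      chainT u ub (fun _ : Fin 1 => i 0) (fun _ => k 0) *
        chainT u ub (Fin.tail i) (Fin.tail k) := by
  have key (i : Fin (N + 1) → Fin d) :
      Fin.append (fun _ : Fin 1 => i 0) (Fin.tail i) = i ∘ Fin.cast (Nat.add_comm 1 N) := by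
    rw [Fin.append_left_eq_cons, Fin.cons_self_tail]
  rw [← chainT_append, key, key, chainT_cast]

theorem chainT_succ' {N : ℕ} (i k : Fin (N + 1) → Fin d) :
    chainT u ub i k =
      chainT u ub (Fin.init i) (Fin.init k) *
        chainT u ub (fun _ : Fin 1 => i (Fin.last N)) (fun _ => k (Fin.last N)) := by
  have key (i : Fin (N + 1) → Fin d) :
      Fin.append (Fin.init i) (fun _ : Fin 1 => i (Fin.last N)) = i := by
    rw [Fin.append_right_eq_snoc, Fin.snoc_init_self]
  rw [← chainT_append, key, key]

variable (φ w : Fin D × Fin D' → ℂ)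

theorem Bmap_apply {N : ℕ} (Y : Matrix (Fin N → Fin d) (Fin N → Fin d) ℂ)
    (I K : Fin N → Fin d) :
    Bmap u ub φ w Y I K =
      ∑ J, ∑ J', Y J J' * (φ ⬝ᵥ (chainProd u I J ⊗ₖ chainProd ub J' K) *ᵥ w) :=
  rfl

theorem recast_Bmap {N N' : ℕ} (h : N = N') (Y : Matrix (Fin N → Fin d) (Fin N → Fin d) ℂ) :
    recast h (Bmap u ub φ w Y) = Bmap u ub φ w (recast h Y) := by
  subst h
  rfl

theorem append_parts {m n k : ℕ} (I : Fin (m + n + k) → Fin d) :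
    Fin.append (Fin.append (leftPart m n k I) (midPart m n k I)) (rightPart m n k I) = I := by
  funext t
  refine Fin.addCases (fun t => Fin.addCases (fun t => ?_) (fun t => ?_) t) (fun t => ?_) t <;>
    simp [leftPart, midPart, rightPart]

@[simp]
theorem leftPart_append {m n k : ℕ} (a : Fin m → Fin d) (b : Fin n → Fin d) (c : Fin k → Fin d) :
    leftPart m n k (Fin.append (Fin.append a b) c) = a := by
  funext t
  simp [leftPart]

@[simp]
theorem midPart_append {m n k : ℕ} (a : Fin m → Fin d) (b : Fin n → Fin d) (c : Fin k → Fin d) :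
    midPart m n k (Fin.append (Fin.append a b) c) = b := by
  funext t
  simp [midPart]

@[simp]
theorem rightPart_append {m n k : ℕ} (a : Fin m → Fin d) (b : Fin n → Fin d)
    (c : Fin k → Fin d) :
    rightPart m n k (Fin.append (Fin.append a b) c) = c := by
  funext t
  simp [rightPart]

/-- The two-layer chain with the observable `X` inserted between the layers. -/
noncomputable def insertedChain {n : ℕ} (X : Matrix (Fin n → Fin d) (Fin n → Fin d) ℂ)
    (b b' : Fin n → Fin d) : Matrix (Fin D × Fin D') (Fin D × Fin D') ℂ :=
  ∑ j, ∑ j', X j j' • (chainProd u b j ⊗ₖ chainProd ub j' b')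

theorem betaMap_append {n m k : ℕ} (X : Matrix (Fin n → Fin d) (Fin n → Fin d) ℂ)
    (a a' : Fin m → Fin d) (b b' : Fin n → Fin d) (c c' : Fin k → Fin d) :
    betaMap u ub φ w n m k X (Fin.append (Fin.append a b) c) (Fin.append (Fin.append a' b') c') =
      φ ⬝ᵥ (chainT u ub a a' * insertedChain u ub X b b' * chainT u ub c c') *ᵥ w := by
  have hsum {ι : Type} (s : Finset ι) (F : ι → Matrix (Fin D × Fin D') (Fin D × Fin D') ℂ) :
      φ ⬝ᵥ (∑ x ∈ s, F x) *ᵥ w = ∑ x ∈ s, φ ⬝ᵥ F x *ᵥ w := by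
    rw [Matrix.sum_mulVec, dotProduct_sum]
  have hsmul (x : ℂ) (F : Matrix (Fin D × Fin D') (Fin D × Fin D') ℂ) :
      φ ⬝ᵥ (x • F) *ᵥ w = x * (φ ⬝ᵥ F *ᵥ w) := by
    rw [Matrix.smul_mulVec, dotProduct_smul, smul_eq_mul]
  simp only [betaMap, Bmap_apply, sum_append, chainProd_append, Matrix.of_apply, leftPart_append,
    midPart_append, rightPart_append, Matrix.mul_kronecker_mul, ite_mul, one_mul, zero_mul,
    Finset.sum_ite_eq, Finset.mem_univ, if_true, Finset.sum_ite_irrel, Finset.sum_const_zero]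
  simp only [chainT_eq_sum, insertedChain, Finset.sum_mul, Finset.mul_sum, hsum, hsmul,
    Matrix.mul_smul, Matrix.smul_mul]
  conv_rhs =>
    enter [2, x, 2, y]
    rw [Finset.sum_comm]
  conv_rhs =>
    enter [2, x]
    rw [Finset.sum_comm]
  rw [Finset.sum_comm (s := (Finset.univ : Finset (Fin k → Fin d)))]
  refine Finset.sum_congr rfl fun x _ => ?_
  rw [Finset.sum_comm (s := (Finset.univ : Finset (Fin k → Fin d)))]

theorem betaMap_apply {n m k : ℕ} (X : Matrix (Fin n → Fin d) (Fin n → Fin d) ℂ)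
    (I K : Fin (m + n + k) → Fin d) :
    betaMap u ub φ w n m k X I K =
      φ ⬝ᵥ (chainT u ub (leftPart m n k I) (leftPart m n k K) *
        insertedChain u ub X (midPart m n k I) (midPart m n k K) *
        chainT u ub (rightPart m n k I) (rightPart m n k K)) *ᵥ w := by
  rw [← betaMap_append, append_parts, append_parts]

theorem recast_betaMap_idTensorLeft {n m k : ℕ} (h : m + (n + 1) + k = (m + 1) + n + k)
    (X : Matrix (Fin n → Fin d) (Fin n → Fin d) ℂ) :
    recast h (betaMap u ub φ w (n + 1) m k (idTensorLeft X)) =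
      betaMap u ub φ w n (m + 1) k X := by
  rw [betaMap, recast_Bmap, betaMap]
  congr 1
  ext I K
  have hl (I : Fin (m + 1 + n + k) → Fin d) : leftPart m (n + 1) k (I ∘ Fin.cast h) =
      Fin.init (leftPart (m + 1) n k I) := rfl
  have h0 (I : Fin (m + 1 + n + k) → Fin d) : midPart m (n + 1) k (I ∘ Fin.cast h) 0 =
      leftPart (m + 1) n k I (Fin.last m) := rfl
  have ht (I : Fin (m + 1 + n + k) → Fin d) : Fin.tail (midPart m (n + 1) k (I ∘ Fin.cast h)) =
      midPart (m + 1) n k I := by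
    funext t
    exact congrArg I (Fin.ext (by simp; omega))
  have hr (I : Fin (m + 1 + n + k) → Fin d) : rightPart m (n + 1) k (I ∘ Fin.cast h) =
      rightPart (m + 1) n k I := by
    funext t
    exact congrArg I (Fin.ext (by simp))
  have hiff : leftPart (m + 1) n k I = leftPart (m + 1) n k K ↔
      Fin.init (leftPart (m + 1) n k I) = Fin.init (leftPart (m + 1) n k K) ∧
        leftPart (m + 1) n k I (Fin.last m) = leftPart (m + 1) n k K (Fin.last m) := by
    simp only [funext_iff, Fin.forall_fin_succ', Fin.init]
  simp only [recast, idTensorLeft, Matrix.of_apply, hl, h0, ht, hr, hiff, ite_and]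
  split_ifs <;> simp

theorem recast_betaMap_tensorIdRight {n m k : ℕ} (h : m + (n + 1) + k = m + n + (k + 1))
    (X : Matrix (Fin n → Fin d) (Fin n → Fin d) ℂ) :
    recast h (betaMap u ub φ w (n + 1) m k (tensorIdRight X)) =
      betaMap u ub φ w n m (k + 1) X := by
  rw [betaMap, recast_Bmap, betaMap]
  congr 1
  ext I K
  have hl (I : Fin (m + n + (k + 1)) → Fin d) : leftPart m (n + 1) k (I ∘ Fin.cast h) =
      leftPart m n (k + 1) I := rfl
  have h0 (I : Fin (m + n + (k + 1)) → Fin d) :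
      midPart m (n + 1) k (I ∘ Fin.cast h) (Fin.last n) = rightPart m n (k + 1) I 0 := rfl
  have ht (I : Fin (m + n + (k + 1)) → Fin d) :
      Fin.init (midPart m (n + 1) k (I ∘ Fin.cast h)) = midPart m n (k + 1) I := rfl
  have hr (I : Fin (m + n + (k + 1)) → Fin d) : rightPart m (n + 1) k (I ∘ Fin.cast h) =
      Fin.tail (rightPart m n (k + 1) I) := by
    funext t
    exact congrArg I (Fin.ext (by simp; omega))
  have hiff : rightPart m n (k + 1) I = rightPart m n (k + 1) K ↔
      rightPart m n (k + 1) I 0 = rightPart m n (k + 1) K 0 ∧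
        Fin.tail (rightPart m n (k + 1) I) = Fin.tail (rightPart m n (k + 1) K) := by
    simp only [funext_iff, Fin.forall_fin_succ, Fin.tail]
  simp only [recast, tensorIdRight, Matrix.of_apply, hl, h0, ht, hr, hiff, ite_and]
  split_ifs <;> simp

theorem betaMap_succ_left {n m k : ℕ} (h : (m + n + k) + 1 = (m + 1) + n + k)
    (hT : ∀ i i' : Fin (m + 1) → Fin d, φ ᵥ* chainT u ub i i' =
      (if i 0 = i' 0 then (1 : ℂ) else 0) • φ ᵥ* chainT u ub (Fin.tail i) (Fin.tail i'))
    (X : Matrix (Fin n → Fin d) (Fin n → Fin d) ℂ) :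
    betaMap u ub φ w n (m + 1) k X = recast h (idTensorLeft (betaMap u ub φ w n m k X)) := by
  ext I K
  have h0 (I : Fin (m + 1 + n + k) → Fin d) :
      leftPart (m + 1) n k I 0 = (I ∘ Fin.cast h) 0 := rfl
  have hl (I : Fin (m + 1 + n + k) → Fin d) : Fin.tail (leftPart (m + 1) n k I) =
      leftPart m n k (Fin.tail (I ∘ Fin.cast h)) := rfl
  have hm (I : Fin (m + 1 + n + k) → Fin d) : midPart (m + 1) n k I =
      midPart m n k (Fin.tail (I ∘ Fin.cast h)) := by
    funext t
    exact congrArg I (Fin.ext (by simp; omega))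
  have hr (I : Fin (m + 1 + n + k) → Fin d) : rightPart (m + 1) n k I =
      rightPart m n k (Fin.tail (I ∘ Fin.cast h)) := by
    funext t
    exact congrArg I (Fin.ext (by simp; omega))
  simp only [recast, idTensorLeft, Matrix.of_apply, betaMap_apply, dotProduct_mulVec,
    ← vecMul_vecMul, hT, smul_vecMul, smul_dotProduct, h0, hl, hm, hr, smul_eq_mul]

theorem betaMap_succ_right {n m k : ℕ} (h : (m + n + k) + 1 = m + n + (k + 1))
    (hT : ∀ i i' : Fin (k + 1) → Fin d, chainT u ub i i' *ᵥ w =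
      (if i (Fin.last k) = i' (Fin.last k) then (1 : ℂ) else 0) •
        chainT u ub (Fin.init i) (Fin.init i') *ᵥ w)
    (X : Matrix (Fin n → Fin d) (Fin n → Fin d) ℂ) :
    betaMap u ub φ w n m (k + 1) X = recast h (tensorIdRight (betaMap u ub φ w n m k X)) := by
  ext I K
  have h0 (I : Fin (m + n + (k + 1)) → Fin d) :
      rightPart m n (k + 1) I (Fin.last k) = (I ∘ Fin.cast h) (Fin.last _) := rfl
  have hl (I : Fin (m + n + (k + 1)) → Fin d) : leftPart m n (k + 1) I =
      leftPart m n k (Fin.init (I ∘ Fin.cast h)) := rfl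
  have hm (I : Fin (m + n + (k + 1)) → Fin d) : midPart m n (k + 1) I =
      midPart m n k (Fin.init (I ∘ Fin.cast h)) := rfl
  have hr (I : Fin (m + n + (k + 1)) → Fin d) : Fin.init (rightPart m n (k + 1) I) =
      rightPart m n k (Fin.init (I ∘ Fin.cast h)) := rfl
  simp only [recast, tensorIdRight, Matrix.of_apply, betaMap_apply, ← mulVec_mulVec, hT,
    mulVec_smul, dotProduct_smul, h0, hl, hm, hr, smul_eq_mul]
  rw [mul_comm]

end Chain

/-- For all `n ≥ 0`, `m, k > M`, and `X` on `n` sites, the maps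
`β^{n,m,k}` are compatible with tensoring by the identity:
`β^{n+1,m,k}(1 ⊗ X) = β^{n,m+1,k}(X) = 1 ⊗ β^{n,m,k}(X)` and
`β^{n+1,m,k}(X ⊗ 1) = β^{n,m,k+1}(X) = β^{n,m,k}(X) ⊗ 1`; hence the finite-size maps
consistently define a single map `β` on local observables. -/
theorem stmt_14 {d D D' : ℕ} (hd : 1 ≤ d) (hD : 1 ≤ D) (hD' : 1 ≤ D')
    (u : Fin d → Fin d → Matrix (Fin D) (Fin D) ℂ)
    (ub : Fin d → Fin d → Matrix (Fin D') (Fin D') ℂ)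
    (φ w : Fin D × Fin D' → ℂ)
    (hφw : (∑ p, φ p * w p) = 1)
    (hCap : ∀ (N : ℕ) (i k : Fin N → Fin d),
      (∑ p, φ p * (chainT u ub i k).mulVec w p) = if i = k then 1 else 0)
    (M : ℕ)
    (hFact : ∀ (m k n : ℕ), M ≤ m → M ≤ k →
      ∀ (i i' : Fin m → Fin d) (j j' : Fin n → Fin d) (l l' : Fin k → Fin d),
        chainT u ub (Fin.append (Fin.append i j) l) (Fin.append (Fin.append i' j') l')
          = (if j = j' then (1 : ℂ) else 0) •
              Matrix.of fun p q =>
                (chainT u ub i i').mulVec w p * Matrix.vecMul φ (chainT u ub l l') q) :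
    ∀ (n m k : ℕ), M < m → M < k →
      ∀ X : Matrix (Fin n → Fin d) (Fin n → Fin d) ℂ,
        recast (show m + (n + 1) + k = (m + 1) + n + k by omega)
            (betaMap u ub φ w (n + 1) m k (idTensorLeft X))
          = betaMap u ub φ w n (m + 1) k X
        ∧ betaMap u ub φ w n (m + 1) k X
          = recast (show (m + n + k) + 1 = (m + 1) + n + k by omega)
              (idTensorLeft (betaMap u ub φ w n m k X))
        ∧ recast (show m + (n + 1) + k = m + n + (k + 1) by omega)
            (betaMap u ub φ w (n + 1) m k (tensorIdRight X))
          = betaMap u ub φ w n m (k + 1) X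
        ∧ betaMap u ub φ w n m (k + 1) X
          = recast (show (m + n + k) + 1 = m + n + (k + 1) by omega)
              (tensorIdRight (betaMap u ub φ w n m k X)) := by
  have hfact0 {m k : ℕ} (hm : M ≤ m) (hk : M ≤ k) (i i' : Fin m → Fin d) (l l' : Fin k → Fin d) :
      chainT u ub i i' * chainT u ub l l' =
        vecMulVec (chainT u ub i i' *ᵥ w) (φ ᵥ* chainT u ub l l') := by
    have h := hFact m k 0 hm hk i i' Fin.elim0 Fin.elim0 l l'
    rw [chainT_append, chainT_append, chainT_zero, mul_one, if_pos rfl, one_smul] at h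
    exact h
  have hfact1 {m k : ℕ} (hm : M ≤ m) (hk : M ≤ k) (i i' : Fin m → Fin d) (a b : Fin d)
      (l l' : Fin k → Fin d) :
      chainT u ub i i' * chainT u ub (fun _ : Fin 1 => a) (fun _ => b) * chainT u ub l l' =
        (if a = b then (1 : ℂ) else 0) •
          vecMulVec (chainT u ub i i' *ᵥ w) (φ ᵥ* chainT u ub l l') := by
    have h := hFact m k 1 hm hk i i' (fun _ => a) (fun _ => b) l l'
    rw [chainT_append, chainT_append] at h
    simp only [funext_iff, forall_const] at h
    exact h
  let c : Fin M → Fin d := fun _ => ⟨0, hd⟩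
  have hc : φ ⬝ᵥ chainT u ub c c *ᵥ w = 1 := (hCap M c c).trans (if_pos rfl)
  have hleft {m : ℕ} (hm : M ≤ m) (i i' : Fin (m + 1) → Fin d) : φ ᵥ* chainT u ub i i' =
      (if i 0 = i' 0 then (1 : ℂ) else 0) • φ ᵥ* chainT u ub (Fin.tail i) (Fin.tail i') := by
    have h := hfact1 le_rfl hm c c (i 0) (i' 0) (Fin.tail i) (Fin.tail i')
    rw [mul_assoc, ← chainT_succ, hfact0 le_rfl (by omega)] at h
    have h' := congrArg (φ ᵥ* ·) h
    simpa only [vecMul_smul, vecMul_vecMulVec, hc, one_smul] using h'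
  have hright {k : ℕ} (hk : M ≤ k) (i i' : Fin (k + 1) → Fin d) : chainT u ub i i' *ᵥ w =
      (if i (Fin.last k) = i' (Fin.last k) then (1 : ℂ) else 0) •
        chainT u ub (Fin.init i) (Fin.init i') *ᵥ w := by
    have h := hfact1 hk le_rfl (Fin.init i) (Fin.init i') (i (Fin.last k)) (i' (Fin.last k)) c c
    rw [← chainT_succ', hfact0 (by omega) le_rfl] at h
    have h' := congrArg (· *ᵥ w) h
    simpa only [smul_mulVec, vecMulVec_mulVec, ← dotProduct_mulVec, hc, MulOpposite.op_one,
      one_smul] using h'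
  intro n m k hm hk X
  exact ⟨recast_betaMap_idTensorLeft u ub φ w _ X,
    betaMap_succ_left u ub φ w _ (hleft hm.le) X,
    recast_betaMap_tensorIdRight u ub φ w _ X,
    betaMap_succ_right u ub φ w _ (hright hk.le) X⟩
end
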